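/- (Berkovich-analytic Koksma inequality) If f : O → ℝ is a continuous (hence Haar-integrable) function and X is a finite nonempty subset of O with discrepancy Δ(X), then |(1/|X|)·Σ_{x∈X} f(x) − ∫_O f dμ| ≤ (1 + 1/q)·V_Berk(f)·Δ(X). -/

import Mathlib

open MeasureTheory Set Filter Topology
open scoped ENNReal NNReal

noncomputable section

namespace NAKoksma

variable (K : Type*) [NontriviallyNormedField K] [IsUltrametricDist K]

/-- The ring of integers `O = {x : K | ‖x‖ ≤ 1}` of a non-Archimedean normed field. -/
def RoI : Subring K where
  carrier := {x : K | ‖x‖ ≤ 1}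
  mul_mem' := fun {a b} ha hb => by
    simp only [Set.mem_setOf_eq] at *
    calc ‖a * b‖ = ‖a‖ * ‖b‖ := norm_mul a b
      _ ≤ 1 * 1 := mul_le_mul ha hb (norm_nonneg b) zero_le_one
      _ = 1 := one_mul 1
  one_mem' := by simp
  add_mem' := fun {a b} ha hb => by
    simp only [Set.mem_setOf_eq] at *
    exact (IsUltrametricDist.norm_add_le_max a b).trans (max_le ha hb)
  zero_mem' := by simp
  neg_mem' := fun {a} ha => by
    simp only [Set.mem_setOf_eq, norm_neg] at *
    exact ha

variable (q : ℕ)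

/-- The disc of radius `q ^ (-n)` centered at `a` in the ring of integers. -/
def disc (a : RoI K) (n : ℕ) : Set (RoI K) :=
  {x : RoI K | ‖(x : K) - (a : K)‖ ≤ (q : ℝ) ^ (-(n : ℤ))}

/-- A subset of `O` is a disc if it is of the form `D_r(a)` with `r = q^(-n)`, `0 < r ≤ 1`. -/
def IsDisc (D : Set (RoI K)) : Prop := ∃ (a : RoI K) (n : ℕ), D = disc K q a n

/-- A Taibleson partition: a finite collection of discs partitioning `O`. -/
def IsTaibPartition (P : Finset (Set (RoI K))) : Prop :=
  (∀ D ∈ P, IsDisc K q D) ∧ (P : Set (Set (RoI K))).PairwiseDisjoint id ∧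
    ⋃₀ (P : Set (Set (RoI K))) = Set.univ

/-- `V_Π(f) = Σ_{D ∈ Π} sup_{x,y ∈ D} (f x - f y)`, valued in `[0,∞]`. -/
def VPi (f : RoI K → ℝ) (P : Finset (Set (RoI K))) : ℝ≥0∞ :=
  ∑ D ∈ P, ⨆ x ∈ D, ⨆ y ∈ D, ENNReal.ofReal (f x - f y)

/-- The Taibleson variation `V_Taib(f) = sup_Π V_Π(f)`. -/
def VTaib (f : RoI K → ℝ) : ℝ≥0∞ :=
  ⨆ P : {P : Finset (Set (RoI K)) // IsTaibPartition K q P}, VPi K f P.1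

variable [MeasurableSpace K]

/-- The discrepancy `Δ(X) = sup_D | |X ∩ D| / |X| - μ(D) |` of a finite set `X ⊆ O`. -/
def discrepancy (μ : Measure (RoI K)) (X : Finset (RoI K)) : ℝ :=
  ⨆ D : {D : Set (RoI K) // IsDisc K q D},
    |(Nat.card ↥((X : Set (RoI K)) ∩ D.1) : ℝ) / (X.card : ℝ) - (μ D.1).toReal|

variable (π : RoI K)

/-- The `i`-th point `m_i = a_0 + a_1 π + ⋯ + a_{λ-1} π^{λ-1}` in the dictionary
ordering of the coefficient strings `(a_0, …, a_{λ-1})` with respect to the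
indexing of the coset representatives `S`. -/
def beerPoint (S : ℕ → RoI K) (lam i : ℕ) : RoI K :=
  ∑ j ∈ Finset.range lam, S (i / q ^ (lam - 1 - j) % q) * π ^ j

/-- `V_λ(f) = sup_{x_i ∈ E_i} Σ_{i=1}^{q^λ - 1} |f(x_i) - f(x_{i-1})|` over the ordered Beer
partition `E_0, …, E_{q^λ - 1}` of level `λ`. -/
def VBeerLevel (S : ℕ → RoI K) (f : RoI K → ℝ) (lam : ℕ) : ℝ≥0∞ :=
  ⨆ x : {x : ℕ → RoI K // ∀ i < q ^ lam, x i ∈ disc K q (beerPoint K q π S lam i) lam},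
    ∑ i ∈ Finset.Ico 1 (q ^ lam), ENNReal.ofReal |f (x.1 i) - f (x.1 (i - 1))|

/-- The Beer variation `V_Beer(f) = lim_{λ→∞} V_λ(f) = sup_{λ ≥ 1} V_λ(f)`. -/
def VBeer (S : ℕ → RoI K) (f : RoI K → ℝ) : ℝ≥0∞ :=
  ⨆ lam : ℕ, VBeerLevel K q π S f (lam + 1)

/-- `S : ℕ → O` (through indices `0, …, q-1`) is a complete ordered system of coset
representatives for the residue field `O/πO`, containing `0`. -/
def IsRepSystem (S : ℕ → RoI K) : Prop :=
  (∃ i, i < q ∧ S i = 0) ∧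
    Function.Bijective fun i : Fin q => Ideal.Quotient.mk (Ideal.span {π}) (S (i : ℕ))

/-- The Berkovich-analytic variation
`V_Berk(f) = Σ_D Σ_{D' ≺ D} |f(D') - f(D)|`, where `D' ≺ D` means `D' ⊆ D` and
`μ(D') = μ(D)/q`, and `f(D)` denotes the average of `f` over `D`. -/
def VBerk (μ : Measure (RoI K)) (f : RoI K → ℝ) : ℝ≥0∞ :=
  ∑' D : {D : Set (RoI K) // IsDisc K q D},
    ∑' D' : {D' : Set (RoI K) // IsDisc K q D' ∧ D' ⊆ D.1 ∧ μ D' = μ D.1 / (q : ℝ≥0∞)},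
      ENNReal.ofReal |(⨍ x in D'.1, f x ∂μ) - ⨍ x in D.1, f x ∂μ|

/-- The level `ℓ(γ)` of a character `γ : O → 𝕋`: the least `ℓ ≥ 0` such that `γ` is trivial
on `π^ℓ O`. -/
def charLevel (γ : AddChar (RoI K) Circle) : ℕ :=
  sInf {l : ℕ | ∀ y : RoI K, γ (π ^ l * y) = 1}

/-- The Fourier coefficient `f̂(γ) = ∫_O f(x) conj(γ(x)) dμ(x)`. -/
def fourierCoeff (μ : Measure (RoI K)) (f : RoI K → ℂ) (γ : AddChar (RoI K) Circle) : ℂ :=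
  ∫ x, f x * (starRingEnd ℂ) ((γ x : Circle) : ℂ) ∂μ

/-- The Fourier-analytic variation `V_Fourier(f) = Σ_{γ ≠ γ₀} q^{ℓ(γ)} |f̂(γ)|`, the sum over
all nontrivial continuous characters of `O`. -/
def VFourier (μ : Measure (RoI K)) (f : RoI K → ℝ) : ℝ≥0∞ :=
  ∑' γ : {γ : AddChar (RoI K) Circle // Continuous ⇑γ ∧ γ ≠ 1},
    ENNReal.ofReal ((q : ℝ) ^ charLevel K π γ.1 * ‖fourierCoeff K μ (fun x => (f x : ℂ)) γ.1‖)

/-- A function is a finite linear combination of characteristic functions of discs. -/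
def IsDiscSimple (g : RoI K → ℝ) : Prop :=
  ∃ (P : Finset (Set (RoI K))) (c : Set (RoI K) → ℝ),
    (∀ D ∈ P, IsDisc K q D) ∧ g = fun x => ∑ D ∈ P, c D * D.indicator 1 x

/-- Integrability in the sense of Beer: `f` can be squeezed between finite linear combinations
of characteristic functions of discs with integrals converging to each other. -/
def BeerIntegrable [MeasurableSpace K] (μ : Measure (RoI K)) (f : RoI K → ℝ) : Prop :=
  ∃ u v : ℕ → RoI K → ℝ,
    (∀ n, IsDiscSimple K q (u n)) ∧ (∀ n, IsDiscSimple K q (v n)) ∧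
    (∀ n x, u n x ≤ f x ∧ f x ≤ v n x) ∧
    Tendsto (fun n => ∫ x, (v n x - u n x) ∂μ) atTop (𝓝 0)

section Discs

variable {L : Type*} [NontriviallyNormedField L] [IsUltrametricDist L] {q : ℕ}

theorem mem_disc_self (a : RoI L) (n : ℕ) : a ∈ disc L q a n := by
  simp only [disc, mem_ofPred_eq, sub_self, norm_zero]
  positivity

theorem epsilon_mem_disc (a : RoI L) (n : ℕ) :
    Classical.epsilon (· ∈ disc L q a n) ∈ disc L q a n :=
  Classical.epsilon_spec (p := (· ∈ disc L q a n)) ⟨a, mem_disc_self a n⟩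

theorem disc_eq_of_mem {a x : RoI L} {n : ℕ} (h : x ∈ disc L q a n) :
    disc L q x n = disc L q a n := by
  have h' : ‖(a : L) - x‖ ≤ (q : ℝ) ^ (-(n : ℤ)) := by rw [norm_sub_rev]; exact h
  ext y
  constructor <;> intro hy
  · have := IsUltrametricDist.norm_add_le_max ((y : L) - x) ((x : L) - a)
    rw [sub_add_sub_cancel] at this
    exact this.trans (max_le hy h)
  · have := IsUltrametricDist.norm_add_le_max ((y : L) - a) ((a : L) - x)
    rw [sub_add_sub_cancel] at this
    exact this.trans (max_le hy h')

theorem disc_zero (a : RoI L) : disc L q a 0 = univ := by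
  refine eq_univ_of_forall fun x => ?_
  have : ‖((x - a : RoI L) : L)‖ ≤ 1 := (x - a).2
  simpa [disc] using this

theorem disc_succ_subset (hq : 1 < q) (a : RoI L) (n : ℕ) :
    disc L q a (n + 1) ⊆ disc L q a n := by
  have hle : (q : ℝ) ^ (-((n + 1 : ℕ) : ℤ)) ≤ (q : ℝ) ^ (-(n : ℤ)) :=
    zpow_le_zpow_right₀ (by exact_mod_cast hq.le) (by lia)
  exact fun x hx => le_trans (show ‖(x : L) - a‖ ≤ _ from hx) hle

theorem isOpen_disc (hq : 0 < q) (a : RoI L) (n : ℕ) : IsOpen (disc L q a n) := by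
  have h := (IsUltrametricDist.isClopen_closedBall (a : L)
    (r := (q : ℝ) ^ (-(n : ℤ))) (by positivity)).isOpen.preimage
    (continuous_subtype_val : Continuous fun x : RoI L => (x : L))
  convert h using 1
  ext x
  simp [disc, dist_eq_norm]

theorem eventually_disc_subset (hq : 1 < q) {a : RoI L} {U : Set (RoI L)} (hU : U ∈ 𝓝 a) :
    ∀ᶠ n in atTop, disc L q a n ⊆ U := by
  obtain ⟨ε, hε, hball⟩ := Metric.mem_nhds_iff.1 hU
  have hlim : Tendsto (fun n : ℕ => ((q : ℝ)⁻¹) ^ n) atTop (𝓝 0) :=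
    tendsto_pow_atTop_nhds_zero_of_lt_one (by positivity)
      (inv_lt_one_of_one_lt₀ (by exact_mod_cast hq))
  filter_upwards [hlim.eventually_lt_const hε] with n hn x hx
  refine hball ?_
  rw [Metric.mem_ball, Subtype.dist_eq, dist_eq_norm]
  refine lt_of_le_of_lt hx ?_
  simpa using hn

theorem isLocallyConstant_disc (hq : 0 < q) (n : ℕ) :
    IsLocallyConstant fun a : RoI L => disc L q a n :=
  (IsLocallyConstant.iff_exists_open _).2 fun a =>
    ⟨disc L q a n, isOpen_disc hq a n, mem_disc_self a n, fun _ hx => disc_eq_of_mem hx⟩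

/-- The disc of level `n` around `0` is the principal ideal generated by `ϖ ^ n`. -/
theorem disc_zero_eq_span_pow {ϖ : RoI L} (hq : 0 < q) (hϖ : ‖(ϖ : L)‖ = (q : ℝ)⁻¹) (n : ℕ) :
    disc L q 0 n = (Ideal.span {ϖ ^ n} : Ideal (RoI L)) := by
  have hnorm : ‖((ϖ ^ n : RoI L) : L)‖ = (q : ℝ) ^ (-(n : ℤ)) := by
    simp [hϖ]
  have hpos : 0 < ‖((ϖ ^ n : RoI L) : L)‖ := by rw [hnorm]; positivity
  ext x
  simp only [disc, mem_ofPred_eq, SetLike.mem_coe, Ideal.mem_span_singleton', ← hnorm]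
  constructor
  · intro hx
    refine ⟨⟨(x : L) / (ϖ ^ n : RoI L), ?_⟩, Subtype.ext ?_⟩
    · change ‖(x : L) / (ϖ ^ n : RoI L)‖ ≤ 1
      rw [norm_div]
      exact (div_le_one hpos).2 (by simpa using hx)
    · exact div_mul_cancel₀ _ (norm_pos_iff.1 hpos)
  · rintro ⟨y, rfl⟩
    have hy : ‖(y : L)‖ ≤ 1 := y.2
    simpa only [ZeroMemClass.coe_zero, sub_zero, MulMemClass.coe_mul, norm_mul] using
      mul_le_of_le_one_left (norm_nonneg _) hy

/-- Index of the ideal generated by a power of a nonzerodivisor. -/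
theorem index_span_pow {R : Type*} [CommRing R] [IsDomain R] {r : R} (hr : r ≠ 0) (n : ℕ) :
    (Ideal.span {r ^ n} : Ideal R).toAddSubgroup.index =
      (Ideal.span {r} : Ideal R).toAddSubgroup.index ^ n := by
  induction n with
  | zero => simp
  | succ n ih =>
    have hinj : Function.Injective (AddMonoidHom.mulLeft (r ^ n)) :=
      mul_right_injective₀ (pow_ne_zero n hr)
    have hmap : ∀ s : R, (Ideal.span {s} : Ideal R).toAddSubgroup.map
        (AddMonoidHom.mulLeft (r ^ n)) = (Ideal.span {r ^ n * s} : Ideal R).toAddSubgroup := by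
      intro s
      ext x
      simp only [AddSubgroup.mem_map, Submodule.mem_toAddSubgroup, Ideal.mem_span_singleton',
        AddMonoidHom.coe_mulLeft]
      constructor
      · rintro ⟨_, ⟨a, rfl⟩, rfl⟩
        exact ⟨a, by ring⟩
      · rintro ⟨a, rfl⟩
        exact ⟨_, ⟨a, rfl⟩, by ring⟩
    have hrel := AddSubgroup.relIndex_map_map_of_injective
      (Ideal.span {r} : Ideal R).toAddSubgroup (Ideal.span {1} : Ideal R).toAddSubgroup hinj
    rw [hmap, hmap, mul_one, ← pow_succ] at hrel
    have hle : (Ideal.span {r ^ (n + 1)} : Ideal R).toAddSubgroup ≤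
        (Ideal.span {r ^ n} : Ideal R).toAddSubgroup :=
      Submodule.toAddSubgroup_mono
        (Ideal.span_singleton_le_span_singleton.2 (pow_dvd_pow r n.le_succ))
    rw [← AddSubgroup.relIndex_mul_index hle, hrel, ih, pow_succ']
    simp

theorem compactSpace_roI [LocallyCompactSpace L] : CompactSpace (RoI L) := by
  have : ProperSpace L := .of_locallyCompactSpace L
  refine isCompact_iff_compactSpace.1 ?_
  convert isCompact_closedBall (0 : L) 1 using 1
  ext x
  simp [RoI]

theorem finite_range_disc [LocallyCompactSpace L] (hq : 0 < q) (n : ℕ) :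
    (range fun a : RoI L => disc L q a n).Finite :=
  have := compactSpace_roI (L := L)
  (isLocallyConstant_disc hq n).range_finite

end Discs

section Koksma

variable {L : Type*} [NontriviallyNormedField L] [IsUltrametricDist L] {q : ℕ}
  [MeasurableSpace L]

theorem abs_sub_le_discrepancy (μ : Measure (RoI L)) [IsProbabilityMeasure μ]
    (X : Finset (RoI L)) {D : Set (RoI L)} (hD : IsDisc L q D) :
    |(Nat.card ↥((X : Set (RoI L)) ∩ D) : ℝ) / (X.card : ℝ) - μ.real D| ≤
      discrepancy L q μ X := by
  refine le_ciSup (f := fun D : {D : Set (RoI L) // IsDisc L q D} =>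
    |(Nat.card ↥((X : Set (RoI L)) ∩ D.1) : ℝ) / (X.card : ℝ) - (μ D.1).toReal|) ?_ ⟨D, hD⟩
  refine ⟨1, ?_⟩
  rintro _ ⟨E, rfl⟩
  have hcard : Nat.card ↥((X : Set (RoI L)) ∩ E.1) ≤ X.card := by
    simpa using Nat.card_mono X.finite_toSet (inter_subset_left (t := E.1))
  have h₁ : (Nat.card ↥((X : Set (RoI L)) ∩ E.1) : ℝ) / (X.card : ℝ) ≤ 1 :=
    div_le_one_of_le₀ (by exact_mod_cast hcard) (by positivity)
  have h₂ : 0 ≤ (Nat.card ↥((X : Set (RoI L)) ∩ E.1) : ℝ) / (X.card : ℝ) := by positivity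
  have h₃ : (μ E.1).toReal ≤ 1 := measureReal_le_one
  have h₄ : 0 ≤ (μ E.1).toReal := ENNReal.toReal_nonneg
  exact abs_le.2 ⟨by linarith, by linarith⟩

/-- The average of `f` over the disc of level `n` containing `x`. -/
def discAverage (q : ℕ) (μ : Measure (RoI L)) (f : RoI L → ℝ) (n : ℕ) (x : RoI L) : ℝ :=
  ⨍ y in disc L q x n, f y ∂μ

/-- The increment of the averages of `f` from the disc of level `n` containing a disc `D` to `D`
itself, read off at a point of `D`. -/
def averageIncrement (q : ℕ) (μ : Measure (RoI L)) (f : RoI L → ℝ) (n : ℕ)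
    (D : Set (RoI L)) : ℝ :=
  (⨍ y in D, f y ∂μ) - discAverage q μ f n (Classical.epsilon (· ∈ D))

theorem discAverage_succ_sub (hq : 1 < q) (μ : Measure (RoI L)) (f : RoI L → ℝ) (n : ℕ)
    (x : RoI L) : discAverage q μ f (n + 1) x - discAverage q μ f n x =
      averageIncrement q μ f n (disc L q x (n + 1)) := by
  unfold averageIncrement discAverage
  rw [disc_eq_of_mem (disc_succ_subset hq x n (epsilon_mem_disc x (n + 1)))]

variable [BorelSpace L]

theorem measurableSet_disc (hq : 0 < q) (a : RoI L) (n : ℕ) : MeasurableSet (disc L q a n) :=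
  (isOpen_disc hq a n).measurableSet

theorem measure_disc {ϖ : RoI L} (hq : 0 < q) (hϖ : ‖(ϖ : L)‖ = (q : ℝ)⁻¹)
    (hres : Nat.card (↥(RoI L) ⧸ (Ideal.span {ϖ} : Ideal ↥(RoI L))) = q)
    (μ : Measure (RoI L)) [IsProbabilityMeasure μ] [μ.IsAddHaarMeasure] (a : RoI L) (n : ℕ) :
    μ (disc L q a n) = ((q : ℝ≥0∞) ^ n)⁻¹ := by
  have hϖ0 : ϖ ≠ 0 := by
    rintro rfl
    simp [eq_comm, hq.ne'] at hϖ
  have htrans : disc L q a n = (fun x => -a + x) ⁻¹' disc L q 0 n := by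
    ext x
    simp [disc, neg_add_eq_sub]
  have hindex : (Ideal.span {ϖ ^ n} : Ideal (RoI L)).toAddSubgroup.index = q ^ n := by
    rw [index_span_pow hϖ0, ← hres]
    rfl
  have : (Ideal.span {ϖ ^ n} : Ideal (RoI L)).toAddSubgroup.FiniteIndex :=
    ⟨by rw [hindex]; positivity⟩
  have hcoe : ((Ideal.span {ϖ ^ n} : Ideal (RoI L)).toAddSubgroup : Set (RoI L)) =
      disc L q 0 n := (disc_zero_eq_span_pow hq hϖ n).symm
  have hmul := AddSubgroup.index_mul_measure (Ideal.span {ϖ ^ n} : Ideal (RoI L)).toAddSubgroup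
    (hcoe ▸ measurableSet_disc hq 0 n) μ
  rw [hcoe, hindex, measure_univ, Nat.cast_pow, mul_comm] at hmul
  rw [htrans, measure_preimage_add]
  exact ENNReal.eq_inv_of_mul_eq_one_left hmul

theorem tendsto_discAverage (hq : 1 < q) (μ : Measure (RoI L)) [IsProbabilityMeasure μ]
    [μ.IsAddHaarMeasure] {f : RoI L → ℝ} (hf : Continuous f) (hfi : Integrable f μ) (x : RoI L) :
    Tendsto (fun n => discAverage q μ f n x) atTop (𝓝 (f x)) := by
  rw [Metric.nhds_basis_closedBall.tendsto_right_iff]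
  intro ε hε
  filter_upwards [eventually_disc_subset hq
    (hf.continuousAt.preimage_mem_nhds (Metric.closedBall_mem_nhds (f x) hε))] with n hn
  have hopen := isOpen_disc (q := q) (zero_lt_one.trans hq) x n
  exact (convex_closedBall (f x) ε).set_average_mem Metric.isClosed_closedBall
    (hopen.measure_ne_zero μ ⟨x, mem_disc_self x n⟩) (measure_ne_top μ _)
    ((ae_restrict_iff' hopen.measurableSet).2 (ae_of_all _ fun y hy => hn hy))
    hfi.integrableOn

variable [LocallyCompactSpace L]

theorem integral_eq_sum_disc (hq : 0 < q) (μ : Measure (RoI L)) {f : RoI L → ℝ}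
    (hf : Integrable f μ) (n : ℕ) :
    ∫ x, f x ∂μ = ∑ D ∈ (finite_range_disc (L := L) hq n).toFinset, ∫ x in D, f x ∂μ := by
  have hunion : ⋃ D ∈ (finite_range_disc (L := L) hq n).toFinset, D = univ :=
    eq_univ_of_forall fun x => mem_biUnion (x := disc L q x n) (by simp) (mem_disc_self x n)
  rw [← integral_biUnion_finset (s := fun D => D), hunion, setIntegral_univ]
  · intro D hD
    obtain ⟨a, rfl⟩ := (Finite.mem_toFinset _).1 hD
    exact measurableSet_disc hq a n
  · intro D hD E hE hDE
    obtain ⟨a, rfl⟩ := (Finite.mem_toFinset _).1 hD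
    obtain ⟨b, rfl⟩ := (Finite.mem_toFinset _).1 hE
    refine disjoint_left.2 fun x hx hx' => hDE ?_
    exact (disc_eq_of_mem hx).symm.trans (disc_eq_of_mem hx')
  · exact fun D _ => hf.integrableOn

/-- The Koksma inequality for a function that is constant on the discs of level `n`. -/
theorem abs_average_sub_integral_le (hq : 0 < q) (μ : Measure (RoI L)) [IsProbabilityMeasure μ]
    (X : Finset (RoI L)) {g : RoI L → ℝ} (hgi : Integrable g μ) {n : ℕ} {c : Set (RoI L) → ℝ}
    (hg : ∀ x, g x = c (disc L q x n)) :
    |(X.card : ℝ)⁻¹ * ∑ x ∈ X, g x - ∫ x, g x ∂μ| ≤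
      (∑ D ∈ (finite_range_disc (L := L) hq n).toFinset, |c D|) * discrepancy L q μ X := by
  classical
  have hint : ∫ x, g x ∂μ =
      ∑ D ∈ (finite_range_disc (L := L) hq n).toFinset, c D * μ.real D := by
    rw [integral_eq_sum_disc hq μ hgi n]
    refine Finset.sum_congr rfl fun D hD => ?_
    obtain ⟨a, rfl⟩ := (Finite.mem_toFinset _).1 hD
    rw [setIntegral_congr_fun (g := fun _ => c (disc L q a n)) (measurableSet_disc hq a n)
      fun x hx => by rw [hg, disc_eq_of_mem hx]]
    simp [mul_comm]
  have hsum : ∑ x ∈ X, g x = ∑ D ∈ (finite_range_disc (L := L) hq n).toFinset,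
      c D * Nat.card ↥((X : Set (RoI L)) ∩ D) := by
    rw [← Finset.sum_fiberwise_of_maps_to (s := X)
      (t := (finite_range_disc (L := L) hq n).toFinset) (g := fun x => disc L q x n)
      fun x _ => by simp]
    refine Finset.sum_congr rfl fun D hD => ?_
    obtain ⟨a, rfl⟩ := (Finite.mem_toFinset _).1 hD
    have hset : (X : Set (RoI L)) ∩ disc L q a n =
        (X.filter fun x => disc L q x n = disc L q a n : Finset (RoI L)) := by
      ext x
      simp only [mem_inter_iff, Finset.mem_coe, Finset.mem_filter, and_congr_right_iff]
      exact fun _ => ⟨disc_eq_of_mem, fun h => h ▸ mem_disc_self x n⟩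
    rw [Finset.sum_congr rfl (g := fun _ => c (disc L q a n))
      fun x hx => by rw [hg, (Finset.mem_filter.1 hx).2], hset]
    simp [mul_comm]
  rw [hint, hsum, Finset.mul_sum, ← Finset.sum_sub_distrib, Finset.sum_mul]
  refine (Finset.abs_sum_le_sum_abs _ _).trans (Finset.sum_le_sum fun D hD => ?_)
  obtain ⟨a, rfl⟩ := (Finite.mem_toFinset _).1 hD
  refine le_trans (le_of_eq ?_) (mul_le_mul_of_nonneg_left
    (abs_sub_le_discrepancy μ X ⟨a, n, rfl⟩) (abs_nonneg (c (disc L q a n))))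
  rw [← abs_mul]
  congr 1
  ring

theorem integrable_discAverage (hq : 0 < q) (μ : Measure (RoI L)) [IsProbabilityMeasure μ]
    (f : RoI L → ℝ) (n : ℕ) : Integrable (discAverage q μ f n) μ := by
  have := compactSpace_roI (L := L)
  have hcont : Continuous (discAverage q μ f n) :=
    ((isLocallyConstant_disc hq n).comp fun D => ⨍ y in D, f y ∂μ).continuous
  exact hcont.integrable_of_hasCompactSupport (HasCompactSupport.of_compactSpace _)

theorem integral_discAverage (hq : 0 < q) (μ : Measure (RoI L)) [IsProbabilityMeasure μ]
    {f : RoI L → ℝ} (hf : Integrable f μ) (n : ℕ) :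
    ∫ x, discAverage q μ f n x ∂μ = ∫ x, f x ∂μ := by
  rw [integral_eq_sum_disc hq μ (integrable_discAverage hq μ f n) n,
    integral_eq_sum_disc hq μ hf n]
  refine Finset.sum_congr rfl fun D hD => ?_
  obtain ⟨a, rfl⟩ := (Finite.mem_toFinset _).1 hD
  rw [← setIntegral_setAverage μ f]
  refine setIntegral_congr_fun (measurableSet_disc hq a n) fun x hx => ?_
  rw [discAverage, disc_eq_of_mem hx]

theorem tsum_averageIncrement_le_VBerk {ϖ : RoI L} (hq : 1 < q) (hϖ : ‖(ϖ : L)‖ = (q : ℝ)⁻¹)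
    (hres : Nat.card (↥(RoI L) ⧸ (Ideal.span {ϖ} : Ideal ↥(RoI L))) = q)
    (μ : Measure (RoI L)) [IsProbabilityMeasure μ] [μ.IsAddHaarMeasure] (f : RoI L → ℝ) :
    ∑' n : ℕ, ∑ D ∈ (finite_range_disc (L := L) (zero_lt_one.trans hq) (n + 1)).toFinset,
      ENNReal.ofReal |averageIncrement q μ f n D| ≤ VBerk L q μ f := by
  have hq0 : 0 < q := zero_lt_one.trans hq
  let ι := Σ n : ℕ, {D // D ∈ (finite_range_disc (L := L) hq0 (n + 1)).toFinset}
  have hrep : ∀ i : ι, i.2.1 = disc L q (Classical.epsilon (· ∈ i.2.1)) (i.1 + 1) := by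
    rintro ⟨n, D, hD⟩
    obtain ⟨a, rfl⟩ := (Finite.mem_toFinset _).1 hD
    exact (disc_eq_of_mem (epsilon_mem_disc a (n + 1))).symm
  have hmeas : ∀ i : ι, μ i.2.1 = ((q : ℝ≥0∞) ^ (i.1 + 1))⁻¹ := fun i => by
    rw [hrep i, measure_disc hq0 hϖ hres]
  let φ : ι → Σ D : {D : Set (RoI L) // IsDisc L q D},
      {D' : Set (RoI L) // IsDisc L q D' ∧ D' ⊆ D.1 ∧ μ D' = μ D.1 / (q : ℝ≥0∞)} := fun i =>
    ⟨⟨disc L q (Classical.epsilon (· ∈ i.2.1)) i.1, _, _, rfl⟩, i.2.1, ⟨_, _, hrep i⟩,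
      (hrep i).trans_subset (disc_succ_subset hq _ _), by
        rw [hmeas, measure_disc hq0 hϖ hres, pow_succ, div_eq_mul_inv,
          ENNReal.mul_inv (by simp) (by simp)]⟩
  have hφ : Function.Injective φ := by
    rintro ⟨n, D⟩ ⟨m, E⟩ h
    have hDE : D.1 = E.1 := congrArg (fun s => s.2.1) h
    have hpow := (hmeas ⟨n, D⟩).symm.trans ((congrArg μ hDE).trans (hmeas ⟨m, E⟩))
    have hnm : n = m := by
      have h' : q ^ (n + 1) = q ^ (m + 1) := by exact_mod_cast inv_injective hpow
      have := Nat.pow_right_injective hq h'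
      lia
    subst hnm
    rw [Subtype.ext hDE]
  have key := ENNReal.tsum_comp_le_tsum_of_injective hφ fun s =>
    ENNReal.ofReal |(⨍ x in s.2.1, f x ∂μ) - ⨍ x in s.1.1, f x ∂μ|
  rw [ENNReal.tsum_sigma', ENNReal.tsum_sigma'] at key
  refine le_trans (le_of_eq (tsum_congr fun n => ?_)) key
  rw [tsum_fintype, ← Finset.sum_coe_sort]
  rfl

end Koksma

variable [LocallyCompactSpace K] [BorelSpace K]

theorem berkovich_koksma_inequality
    (hq : 1 < q)
    (hπ : ‖(π : K)‖ = (q : ℝ)⁻¹)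
    (hunif : ∀ x : RoI K, ‖(x : K)‖ < 1 → ‖(x : K)‖ ≤ ‖(π : K)‖)
    (hres : Nat.card (↥(RoI K) ⧸ (Ideal.span {π} : Ideal ↥(RoI K))) = q)
    (μ : Measure (RoI K)) [IsProbabilityMeasure μ] [μ.IsAddHaarMeasure]
    (f : RoI K → ℝ) (hf : Continuous f)
    (X : Finset (RoI K)) (hX : X.Nonempty) :
    ENNReal.ofReal |(X.card : ℝ)⁻¹ * ∑ x ∈ X, f x - ∫ x, f x ∂μ| ≤
      (1 + (q : ℝ≥0∞)⁻¹) * VBerk K q μ f * ENNReal.ofReal (discrepancy K q μ X) := by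
  have hq0 : 0 < q := zero_lt_one.trans hq
  have := compactSpace_roI (L := K)
  have hfi : Integrable f μ :=
    hf.integrable_of_hasCompactSupport (HasCompactSupport.of_compactSpace f)
  set V : ℕ → ℝ := fun n => ∑ D ∈ (finite_range_disc (L := K) hq0 (n + 1)).toFinset,
    |averageIncrement q μ f n D|
  have hstep : ∀ n, |(X.card : ℝ)⁻¹ * ∑ x ∈ X, discAverage q μ f (n + 1) x -
      (X.card : ℝ)⁻¹ * ∑ x ∈ X, discAverage q μ f n x| ≤ V n * discrepancy K q μ X := by
    intro n
    have h := abs_average_sub_integral_le hq0 μ X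
      ((integrable_discAverage hq0 μ f (n + 1)).sub (integrable_discAverage hq0 μ f n))
      (discAverage_succ_sub hq μ f n)
    simp only [Pi.sub_apply] at h
    rwa [integral_sub (integrable_discAverage hq0 μ f (n + 1)) (integrable_discAverage hq0 μ f n),
      integral_discAverage hq0 μ hfi, integral_discAverage hq0 μ hfi, sub_self, sub_zero,
      Finset.sum_sub_distrib, mul_sub] at h
  have hbase : (X.card : ℝ)⁻¹ * ∑ x ∈ X, discAverage q μ f 0 x = ∫ x, f x ∂μ := by
    have hcard : (X.card : ℝ) ≠ 0 := by exact_mod_cast hX.card_pos.ne'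
    simp [discAverage, disc_zero, average_eq, hcard]
  have hΔ : 0 ≤ discrepancy K q μ X :=
    (abs_nonneg _).trans (abs_sub_le_discrepancy μ X ⟨0, 0, rfl⟩)
  have hpartial : ∀ N, |(X.card : ℝ)⁻¹ * ∑ x ∈ X, discAverage q μ f N x - ∫ x, f x ∂μ| ≤
      (∑ n ∈ Finset.range N, V n) * discrepancy K q μ X := by
    intro N
    rw [← hbase, ← Finset.sum_range_sub
      (fun n => (X.card : ℝ)⁻¹ * ∑ x ∈ X, discAverage q μ f n x), Finset.sum_mul]
    exact (Finset.abs_sum_le_sum_abs _ _).trans (Finset.sum_le_sum fun n _ => hstep n)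
  have hV0 : ∀ n, 0 ≤ V n := fun n => Finset.sum_nonneg fun _ _ => abs_nonneg _
  have hbound : ∀ N, ENNReal.ofReal
      |(X.card : ℝ)⁻¹ * ∑ x ∈ X, discAverage q μ f N x - ∫ x, f x ∂μ| ≤
      VBerk K q μ f * ENNReal.ofReal (discrepancy K q μ X) := by
    intro N
    refine (ENNReal.ofReal_le_ofReal (hpartial N)).trans ?_
    rw [ENNReal.ofReal_mul (Finset.sum_nonneg fun n _ => hV0 n),
      ENNReal.ofReal_sum_of_nonneg fun n _ => hV0 n]
    gcongr
    refine le_trans ?_ (tsum_averageIncrement_le_VBerk hq hπ hres μ f)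
    refine le_trans (Finset.sum_le_sum fun n _ => ?_) (ENNReal.sum_le_tsum (Finset.range N))
    exact (ENNReal.ofReal_sum_of_nonneg fun _ _ => abs_nonneg _).le
  have hlim : Tendsto (fun N => ENNReal.ofReal
      |(X.card : ℝ)⁻¹ * ∑ x ∈ X, discAverage q μ f N x - ∫ x, f x ∂μ|) atTop
      (𝓝 (ENNReal.ofReal |(X.card : ℝ)⁻¹ * ∑ x ∈ X, f x - ∫ x, f x ∂μ|)) :=
    ENNReal.tendsto_ofReal (((tendsto_finsetSum X fun x _ =>
      tendsto_discAverage hq μ hf hfi x).const_mul _).sub_const _).abs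
  refine (le_of_tendsto' hlim hbound).trans ?_
  gcongr
  exact le_mul_of_one_le_left' le_self_add

end NAKoksma
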